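/- Let Q be a set equipped with a preorder ≤, let D ⊆ Q, and let R be a symmetric binary relation on Q such that R p q implies p ∈ D and q ∈ D, and such that the following extension property holds: whenever R p q and p ≤ p′, there exist p″ and q″ with p′ ≤ p″, q ≤ q″, and R p″ q″. Define p → q to mean that there is a finite sequence p = r₀, r₁, …, r_{m−1} = q such that for each k < m−1 either r_k ≤ r_{k+1} or R r_k r_{k+1}. Let E ⊆ D be →-open within D, meaning: if q ∈ E, q → r, and r ∈ D, then r ∈ E. Then for all p, q ∈ D with p → q and q ∈ E, there exists p′ ∈ E with p ≤ p′. -/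

import Mathlib

/-- `chainArrow le R p q` : there is a finite sequence `p = r 0, …, r (m-1) = q`
such that each consecutive pair is related by `le` or by `R`
(Definition 4.4 of the paper). -/
def chainArrow {Q : Type*} (le R : Q → Q → Prop) (p q : Q) : Prop :=
  ∃ (m : ℕ) (r : ℕ → Q), 0 < m ∧ r 0 = p ∧ r (m - 1) = q ∧
    ∀ k : ℕ, k + 1 < m → (le (r k) (r (k + 1)) ∨ R (r k) (r (k + 1)))

theorem chainArrow_of_step {Q : Type*} {le R : Q → Q → Prop} {p q : Q}
    (h : le p q ∨ R p q) : chainArrow le R p q := by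
  refine ⟨2, fun k => if k = 0 then p else q, by omega, by simp, by simp, fun k hk => ?_⟩
  obtain rfl : k = 0 := by omega
  simpa using h

/-- Induction along a chain, starting from its last element. -/
theorem chainArrow.head_induction {Q : Type*} {le R : Q → Q → Prop} {P : Q → Prop} {p q : Q}
    (h : chainArrow le R p q) (hq : P q)
    (step : ∀ a b, le a b ∨ R a b → P b → P a) : P p := by
  obtain ⟨m, r, hm, rfl, rfl, hr⟩ := h
  exact Nat.decreasingInduction (motive := fun k _ => P (r k))
    (fun k hk ih => step _ _ (hr k (by omega)) ih) hq (Nat.zero_le (m - 1))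

/-- Zig-zag step of Lemma 4.5: if `E ⊆ D` is `→`-open within `D`, then any
`p ∈ D` with `p → q` for some `q ∈ E` can be `≤`-extended into `E`. -/
theorem stmt_4 {Q : Type*} [Preorder Q] (D : Set Q) (R : Q → Q → Prop)
    (hsymm : ∀ p q, R p q → R q p)
    (hdom : ∀ p q, R p q → p ∈ D ∧ q ∈ D)
    (hext : ∀ p q p', R p q → p ≤ p' →
      ∃ p'' q'', p' ≤ p'' ∧ q ≤ q'' ∧ R p'' q'')
    (E : Set Q) (hED : E ⊆ D)
    (hopen : ∀ q ∈ E, ∀ r ∈ D, chainArrow (· ≤ ·) R q r → r ∈ E)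
    (p q : Q) (hp : p ∈ D) (hq : q ∈ D)
    (hpq : chainArrow (· ≤ ·) R p q) (hqE : q ∈ E) :
    ∃ p' ∈ E, p ≤ p' := by
  refine hpq.head_induction (P := fun a => ∃ s ∈ E, a ≤ s) ⟨q, hqE, le_rfl⟩ ?_
  rintro a b (hab | hab) ⟨s, hs, hbs⟩
  · exact ⟨s, hs, hab.trans hbs⟩
  · obtain ⟨s', t, hss', hat, hst⟩ := hext b a s (hsymm a b hab) hbs
    obtain ⟨hs'D, htD⟩ := hdom s' t hst
    have hs' : s' ∈ E := hopen s hs s' hs'D (chainArrow_of_step (.inl hss'))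
    exact ⟨t, hopen s' hs' t htD (chainArrow_of_step (.inr hst)), hat⟩
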